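/- For every integer n ≥ 4 there exists an orthogonal projection P on ℂ^{n+1} with P E P = 0, P F P = 0, and P H₀ P = 0 (so the corresponding quantum code has minimum distance at least 2 for the 𝔰𝔲(2) quantum metric), whose rank equals: n/3 + 1 if n ≡ 0 (mod 6); (n−1)/3 if n ≡ 1 (mod 6); (n+1)/3 if n ≡ 2 (mod 6); n/3 if n ≡ 3 (mod 6); (n+2)/3 if n ≡ 4 (mod 6); (n+1)/3 if n ≡ 5 (mod 6). -/

import Mathlib

noncomputable section

open Matrix

/-- The raising operator `E` of the `𝔰𝔲(2)` quantum metric on `ℂ^{n+1}`, in the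
orthonormal basis `|k⟩` (`k ≡ n (mod 2)`, `−n ≤ k ≤ n`) indexed by `j : Fin (n+1)`
via `k = 2j − n`:  `E|k⟩ = √((n−k)(n+k+2)/4)|k+2⟩` and `E|n⟩ = 0`. -/
def opE (n : ℕ) : Matrix (Fin (n + 1)) (Fin (n + 1)) ℂ :=
  Matrix.of fun a b =>
    if (a : ℕ) = (b : ℕ) + 1 then
      ((Real.sqrt (((n : ℝ) - (b : ℕ)) * ((b : ℕ) + 1)) : ℝ) : ℂ) else 0

/-- The lowering operator `F` of the `𝔰𝔲(2)` quantum metric on `ℂ^{n+1}`: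
`F|k⟩ = √((n−k+2)(n+k)/4)|k−2⟩` and `F|−n⟩ = 0`. -/
def opF (n : ℕ) : Matrix (Fin (n + 1)) (Fin (n + 1)) ℂ :=
  Matrix.of fun a b =>
    if (b : ℕ) = (a : ℕ) + 1 then
      ((Real.sqrt (((b : ℕ) : ℝ) * ((n : ℝ) + 1 - (b : ℕ))) : ℝ) : ℂ) else 0

/-- The diagonal operator `H₀` of the `𝔰𝔲(2)` quantum metric on `ℂ^{n+1}`:
`H₀|k⟩ = k|k⟩`. -/
def opH (n : ℕ) : Matrix (Fin (n + 1)) (Fin (n + 1)) ℂ :=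
  Matrix.diagonal fun j => 2 * ((j : ℕ) : ℂ) - (n : ℂ)

/-- Matrix whose columns are `a i |p i⟩ + b i |q i⟩`. -/
def colU {n : ℕ} {ι : Type} (p q : ι → Fin (n + 1)) (a b : ι → ℝ) :
    Matrix (Fin (n + 1)) ι ℂ :=
  Matrix.of fun j i => (if j = p i then (a i : ℂ) else 0) + (if j = q i then (b i : ℂ) else 0)

lemma colU_sandwich {n : ℕ} {ι : Type} (p q : ι → Fin (n + 1)) (a b : ι → ℝ)
    (M : Matrix (Fin (n + 1)) (Fin (n + 1)) ℂ) (i i' : ι) :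
    ((colU p q a b)ᴴ * M * colU p q a b) i i' =
      a i * a i' * M (p i) (p i') + a i * b i' * M (p i) (q i')
      + b i * a i' * M (q i) (p i') + b i * b i' * M (q i) (q i') := by
  simp only [Matrix.mul_apply, Matrix.conjTranspose_apply, colU, Matrix.of_apply, star_add,
    apply_ite star, star_zero, mul_add, add_mul, Finset.sum_add_distrib, ite_mul, mul_ite,
    zero_mul, mul_zero, Finset.sum_ite_eq', Finset.mem_univ, if_true,
    Complex.star_def, Complex.conj_ofReal]
  ring

lemma opF_eq (n : ℕ) : opF n = (opE n)ᴴ := by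
  ext x y
  simp only [opF, opE, Matrix.of_apply, Matrix.conjTranspose_apply]
  split_ifs with h
  · rw [Complex.star_def, Complex.conj_ofReal]
    congr 2
    rw [h]; push_cast; ring
  · simp

open scoped ComplexOrder in
lemma key {n : ℕ} {ι : Type} [Fintype ι] [DecidableEq ι] (p q : ι → Fin (n + 1)) (a b : ι → ℝ)
    (h1 : (colU p q a b)ᴴ * (1 : Matrix (Fin (n + 1)) (Fin (n + 1)) ℂ) * colU p q a b = 1)
    (hE : (colU p q a b)ᴴ * opE n * colU p q a b = 0)
    (hH : (colU p q a b)ᴴ * opH n * colU p q a b = 0) :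
    ∃ P : Matrix (Fin (n + 1)) (Fin (n + 1)) ℂ,
      Pᴴ = P ∧ P * P = P ∧
      P * opE n * P = 0 ∧ P * opF n * P = 0 ∧ P * opH n * P = 0 ∧
      P.rank = Fintype.card ι := by
  set U := colU p q a b
  rw [Matrix.mul_one] at h1
  have hF : Uᴴ * opF n * U = 0 := by
    have := congrArg Matrix.conjTranspose hE
    simpa [opF_eq, Matrix.conjTranspose_mul, Matrix.mul_assoc] using this
  have sand : ∀ M : Matrix (Fin (n + 1)) (Fin (n + 1)) ℂ, Uᴴ * M * U = 0 →
      (U * Uᴴ) * M * (U * Uᴴ) = 0 := by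
    intro M hM
    calc (U * Uᴴ) * M * (U * Uᴴ) = U * (Uᴴ * M * U) * Uᴴ := by simp only [Matrix.mul_assoc]
      _ = 0 := by rw [hM]; simp
  refine ⟨U * Uᴴ, by simp [Matrix.conjTranspose_mul], ?_, sand _ hE, sand _ hF, sand _ hH, ?_⟩
  · calc (U * Uᴴ) * (U * Uᴴ) = U * (Uᴴ * U) * Uᴴ := by simp only [Matrix.mul_assoc]
      _ = _ := by rw [h1, Matrix.mul_one]
  · rw [Matrix.rank_self_mul_conjTranspose, ← Matrix.rank_conjTranspose_mul_self, h1,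
      Matrix.rank_one]

lemma c_symm (n s : ℕ) (hs : s + 1 ≤ n) :
    Real.sqrt (((n : ℝ) - ((n - s - 1 : ℕ) : ℝ)) * (((n - s - 1 : ℕ) : ℝ) + 1))
      = Real.sqrt (((n : ℝ) - (s : ℝ)) * ((s : ℝ) + 1)) := by
  congr 1
  have : ((n - s - 1 : ℕ) : ℝ) = n - s - 1 := by
    rw [Nat.sub_sub, Nat.cast_sub hs]; push_cast; ring
  rw [this]; ring

/-- first position of each code vector -/
def posP (n M e y : ℕ) : (Fin M × Bool) ⊕ Fin e → ℕ
  | .inl (t, true) => n - 3 * t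
  | .inl (t, false) => 3 * t
  | .inr _ => y

/-- second position of each code vector -/
def posQ (n M e y : ℕ) : (Fin M × Bool) ⊕ Fin e → ℕ
  | .inl (t, true) => 3 * t + 1
  | .inl (t, false) => n - 3 * t - 1
  | .inr _ => n - y

/-- first amplitude -/
def ampA (n M e : ℕ) (al : ℝ) : (Fin M × Bool) ⊕ Fin e → ℝ
  | .inl (t, _) => Real.sqrt (((n : ℝ) - 6 * (t : ℕ) - 2) / (2 * ((n : ℝ) - 6 * (t : ℕ)) - 2))
  | .inr _ => al

/-- second amplitude -/
def ampB (n M e : ℕ) (be : ℝ) : (Fin M × Bool) ⊕ Fin e → ℝ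
  | .inl (t, true) => Real.sqrt (((n : ℝ) - 6 * (t : ℕ)) / (2 * ((n : ℝ) - 6 * (t : ℕ)) - 2))
  | .inl (t, false) => -Real.sqrt (((n : ℝ) - 6 * (t : ℕ)) / (2 * ((n : ℝ) - 6 * (t : ℕ)) - 2))
  | .inr _ => be

lemma amp_one (n t : ℕ) (h : 6 * t + 3 < n) :
    (Real.sqrt (((n : ℝ) - 6 * t - 2) / (2 * ((n : ℝ) - 6 * t) - 2))) ^ 2 +
    (Real.sqrt (((n : ℝ) - 6 * t) / (2 * ((n : ℝ) - 6 * t) - 2))) ^ 2 = 1 := by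
  have h' : (6 * (t : ℝ) + 3) < n := by exact_mod_cast h
  rw [Real.sq_sqrt (div_nonneg (by linarith) (by linarith)),
    Real.sq_sqrt (div_nonneg (by linarith) (by linarith)), ← add_div, div_eq_one_iff_eq]
  · ring
  · intro h0; linarith

lemma amp_H (n t : ℕ) (h : 6 * t + 3 < n) :
    (Real.sqrt (((n : ℝ) - 6 * t - 2) / (2 * ((n : ℝ) - 6 * t) - 2))) ^ 2 * (n - 6 * t) -
    (Real.sqrt (((n : ℝ) - 6 * t) / (2 * ((n : ℝ) - 6 * t) - 2))) ^ 2 * (n - 6 * t - 2) = 0 := by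
  have h' : (6 * (t : ℝ) + 3) < n := by exact_mod_cast h
  rw [Real.sq_sqrt (div_nonneg (by linarith) (by linarith)),
    Real.sq_sqrt (div_nonneg (by linarith) (by linarith))]
  ring

/-- entries of the identity matrix -/
def entI (x y : ℕ) : ℂ := if x = y then 1 else 0

/-- entries of `H₀` -/
def entH (n x y : ℕ) : ℂ := if x = y then 2 * (x : ℂ) - n else 0

/-- entries of `E` -/
def entE (n x y : ℕ) : ℂ := if x = y + 1 then
  ((Real.sqrt (((n : ℝ) - (y : ℝ)) * ((y : ℝ) + 1)) : ℝ) : ℂ) else 0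

lemma one_mk (m x y : ℕ) (hx : x < m) (hy : y < m) :
    (1 : Matrix (Fin m) (Fin m) ℂ) ⟨x, hx⟩ ⟨y, hy⟩ = entI x y := by
  simp [Matrix.one_apply, entI]

lemma one_tt (M e x y : ℕ) (hx : x < M) (hy : y < M) :
    (1 : Matrix ((Fin M × Bool) ⊕ Fin e) ((Fin M × Bool) ⊕ Fin e) ℂ)
      (.inl (⟨x, hx⟩, true)) (.inl (⟨y, hy⟩, true)) = if x = y then 1 else 0 := by
  simp [Matrix.one_apply]

lemma one_ff (M e x y : ℕ) (hx : x < M) (hy : y < M) :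
    (1 : Matrix ((Fin M × Bool) ⊕ Fin e) ((Fin M × Bool) ⊕ Fin e) ℂ)
      (.inl (⟨x, hx⟩, false)) (.inl (⟨y, hy⟩, false)) = if x = y then 1 else 0 := by
  simp [Matrix.one_apply]

lemma one_tf (M e x y : ℕ) (hx : x < M) (hy : y < M) :
    (1 : Matrix ((Fin M × Bool) ⊕ Fin e) ((Fin M × Bool) ⊕ Fin e) ℂ)
      (.inl (⟨x, hx⟩, true)) (.inl (⟨y, hy⟩, false)) = 0 := by
  simp [Matrix.one_apply]

lemma one_ft (M e x y : ℕ) (hx : x < M) (hy : y < M) :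
    (1 : Matrix ((Fin M × Bool) ⊕ Fin e) ((Fin M × Bool) ⊕ Fin e) ℂ)
      (.inl (⟨x, hx⟩, false)) (.inl (⟨y, hy⟩, true)) = 0 := by
  simp [Matrix.one_apply]

lemma one_inr (M e x y : ℕ) (hx : x < e) (hy : y < e) :
    (1 : Matrix ((Fin M × Bool) ⊕ Fin e) ((Fin M × Bool) ⊕ Fin e) ℂ)
      (.inr ⟨x, hx⟩) (.inr ⟨y, hy⟩) = if x = y then 1 else 0 := by
  simp [Matrix.one_apply]

lemma one_lr (M e : ℕ) (x : Fin M × Bool) (y : Fin e) :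
    (1 : Matrix ((Fin M × Bool) ⊕ Fin e) ((Fin M × Bool) ⊕ Fin e) ℂ) (.inl x) (.inr y) = 0 := by
  simp [Matrix.one_apply]

lemma one_rl (M e : ℕ) (x : Fin M × Bool) (y : Fin e) :
    (1 : Matrix ((Fin M × Bool) ⊕ Fin e) ((Fin M × Bool) ⊕ Fin e) ℂ) (.inr y) (.inl x) = 0 := by
  simp [Matrix.one_apply]

lemma H_mk (n x y : ℕ) (hx : x < n + 1) (hy : y < n + 1) :
    opH n ⟨x, hx⟩ ⟨y, hy⟩ = entH n x y := by
  simp [opH, Matrix.diagonal_apply, entH]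

lemma E_mk (n x y : ℕ) (hx : x < n + 1) (hy : y < n + 1) :
    opE n ⟨x, hx⟩ ⟨y, hy⟩ = entE n x y := by
  simp only [opE, Matrix.of_apply, entE]

set_option maxHeartbeats 4000000 in
lemma construct (n M e y : ℕ) (al be : ℝ) (hM : 6 * M < n + 3) (he : e ≤ 1)
    (hy : e = 0 ∨ (3 * M ≤ y ∧ ((2 * y = n ∧ al = 1 ∧ be = 0) ∨
      (2 * y + 3 = n ∧ al ^ 2 + be ^ 2 = 1 ∧ al ^ 2 = be ^ 2)))) :
    ∃ P : Matrix (Fin (n + 1)) (Fin (n + 1)) ℂ,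
      Pᴴ = P ∧ P * P = P ∧
      P * opE n * P = 0 ∧ P * opF n * P = 0 ∧ P * opH n * P = 0 ∧
      P.rank = 2 * M + e := by
  have hp : ∀ i, posP n M e y i < n + 1 := by
    rintro (⟨⟨t, ht⟩, _ | _⟩ | ⟨x, hx⟩) <;> simp only [posP] <;> omega
  have hq : ∀ i, posQ n M e y i < n + 1 := by
    rintro (⟨⟨t, ht⟩, _ | _⟩ | ⟨x, hx⟩) <;> simp only [posQ] <;> omega
  have hcard : Fintype.card ((Fin M × Bool) ⊕ Fin e) = 2 * M + e := by
    simp; ring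
  have amp1 : ∀ t : ℕ, t < M →
      ((Real.sqrt (((n : ℝ) - 6 * t - 2) / (2 * ((n : ℝ) - 6 * t) - 2)) : ℝ) : ℂ) ^ 2 +
      ((Real.sqrt (((n : ℝ) - 6 * t) / (2 * ((n : ℝ) - 6 * t) - 2)) : ℝ) : ℂ) ^ 2 = 1 := by
    intro t ht
    exact_mod_cast amp_one n t (by omega)
  have ampH : ∀ t : ℕ, t < M →
      ((Real.sqrt (((n : ℝ) - 6 * t - 2) / (2 * ((n : ℝ) - 6 * t) - 2)) : ℝ) : ℂ) ^ 2
        * ((n : ℂ) - 6 * t) -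
      ((Real.sqrt (((n : ℝ) - 6 * t) / (2 * ((n : ℝ) - 6 * t) - 2)) : ℝ) : ℂ) ^ 2
        * ((n : ℂ) - 6 * t - 2) = 0 := by
    intro t ht
    have := congrArg (fun x : ℝ => (x : ℂ)) (amp_H n t (by omega))
    push_cast at this
    exact this
  rw [← hcard]
  apply key (fun i => ⟨posP n M e y i, hp i⟩) (fun i => ⟨posQ n M e y i, hq i⟩)
    (ampA n M e al) (ampB n M e be)
  · ext i i'
    rw [colU_sandwich]
    rcases i with ⟨⟨t, ht⟩, _ | _⟩ | ⟨x, hx⟩ <;>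
    rcases i' with ⟨⟨t', ht'⟩, _ | _⟩ | ⟨x', hx'⟩ <;>
    simp only [one_mk, one_tt, one_ff, one_tf, one_ft, one_inr, one_lr, one_rl, posP, posQ, ampA, ampB, Complex.ofReal_neg]
    all_goals simp only [entI]
    all_goals first
      | (rcases eq_or_ne t t' with rfl | htt
         · have h1 := amp1 t ht
           split_ifs <;> first | (exfalso; omega) | linear_combination h1 | ring1
         · split_ifs <;> first | (exfalso; omega) | ring1)
      | (split_ifs <;> first | (exfalso; omega) | ring1)
      | (rcases hy with hy | ⟨hy0, ⟨hy1, rfl, rfl⟩ | ⟨hy1, hy2, hy3⟩⟩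
         · omega
         · split_ifs <;> first | (exfalso; omega) | norm_num
         · have h2 : (al : ℂ) ^ 2 + (be : ℂ) ^ 2 = 1 := by exact_mod_cast hy2
           split_ifs <;> first | (exfalso; omega) | linear_combination h2)
  · ext i i'
    rw [colU_sandwich]
    rcases i with ⟨⟨t, ht⟩, _ | _⟩ | ⟨x, hx⟩ <;>
    rcases i' with ⟨⟨t', ht'⟩, _ | _⟩ | ⟨x', hx'⟩ <;>
    simp only [E_mk, Matrix.zero_apply, posP, posQ, ampA, ampB, Complex.ofReal_neg]
    all_goals simp only [entE]
    all_goals first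
      | (rcases eq_or_ne t t' with rfl | htt
         · rw [c_symm n (3 * t) (by omega)]
           split_ifs <;> first | (exfalso; omega) | ring1
         · split_ifs <;> first | (exfalso; omega) | ring1)
      | (split_ifs <;> first | (exfalso; omega) | ring1)
  · ext i i'
    rw [colU_sandwich]
    rcases i with ⟨⟨t, ht⟩, _ | _⟩ | ⟨x, hx⟩ <;>
    rcases i' with ⟨⟨t', ht'⟩, _ | _⟩ | ⟨x', hx'⟩ <;>
    simp only [H_mk, Matrix.zero_apply, posP, posQ, ampA, ampB, Complex.ofReal_neg]
    all_goals simp only [entH]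
    all_goals first
      | (rcases eq_or_ne t t' with rfl | htt
         · have h1 := ampH t ht
           have c1 : ((n - 3 * t : ℕ) : ℂ) = n - 3 * t := by
             rw [Nat.cast_sub (by omega)]; push_cast; ring
           have c2 : ((n - 3 * t - 1 : ℕ) : ℂ) = n - 3 * t - 1 := by
             rw [Nat.sub_sub, Nat.cast_sub (by omega)]; push_cast; ring
           simp only [c1, c2]
           push_cast
           split_ifs <;> first
             | (exfalso; omega) | linear_combination h1 | linear_combination -h1 | ring1
         · split_ifs <;> first | (exfalso; omega) | ring1)
      | (split_ifs <;> first | (exfalso; omega) | ring1)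
      | (rcases hy with hy | ⟨hy0, ⟨hy1, rfl, rfl⟩ | ⟨hy1, hy2, hy3⟩⟩
         · omega
         · have c3 : (n : ℂ) = 2 * y := by exact_mod_cast hy1.symm
           split_ifs <;> first | (exfalso; omega) | simp [c3]
         · have h2 : (al : ℂ) ^ 2 = (be : ℂ) ^ 2 := by exact_mod_cast hy3
           have c3 : (n : ℂ) = 2 * y + 3 := by exact_mod_cast hy1.symm
           have c4 : ((n - y : ℕ) : ℂ) = n - y := Nat.cast_sub (by omega)
           simp only [c4, c3]
           split_ifs <;> first | (exfalso; omega) | linear_combination -3 * h2)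

/-- Existence of the distance-2 quantum codes of density `1/3` for the `𝔰𝔲(2)`
quantum metrics: for every `n ≥ 4` there is an orthogonal projection `P` on `ℂ^{n+1}`
with `P E P = 0`, `P F P = 0`, `P H₀ P = 0`, whose rank is the value prescribed by
`n mod 6`. -/
theorem su2_distance_two_code_exists (n : ℕ) (hn : 4 ≤ n) :
    ∃ P : Matrix (Fin (n + 1)) (Fin (n + 1)) ℂ,
      Pᴴ = P ∧ P * P = P ∧
      P * opE n * P = 0 ∧ P * opF n * P = 0 ∧ P * opH n * P = 0 ∧
      P.rank =
        (if n % 6 = 0 then n / 3 + 1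
          else if n % 6 = 1 then (n - 1) / 3
          else if n % 6 = 2 then (n + 1) / 3
          else if n % 6 = 3 then n / 3
          else if n % 6 = 4 then (n + 2) / 3
          else (n + 1) / 3) := by
  obtain ⟨m, hm⟩ : ∃ m, n = 6 * m + n % 6 := ⟨n / 6, by omega⟩
  have hr : n % 6 < 6 := Nat.mod_lt _ (by norm_num)
  have hs : (Real.sqrt (1 / 2)) ^ 2 = 1 / 2 := Real.sq_sqrt (by norm_num)
  generalize n % 6 = r at hm hr
  have h : ∃ M e y : ℕ, ∃ al be : ℝ, 6 * M < n + 3 ∧ e ≤ 1 ∧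
      (e = 0 ∨ (3 * M ≤ y ∧ ((2 * y = n ∧ al = 1 ∧ be = 0) ∨
      (2 * y + 3 = n ∧ al ^ 2 + be ^ 2 = 1 ∧ al ^ 2 = be ^ 2)))) ∧
      2 * M + e = (if r = 0 then n / 3 + 1
          else if r = 1 then (n - 1) / 3
          else if r = 2 then (n + 1) / 3
          else if r = 3 then n / 3
          else if r = 4 then (n + 2) / 3
          else (n + 1) / 3) := by
    interval_cases r
    · exact ⟨m, 1, 3 * m, 1, 0, by omega, by omega,
        Or.inr ⟨by omega, Or.inl ⟨by omega, rfl, rfl⟩⟩, by norm_num; omega⟩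
    · exact ⟨m, 0, 0, 1, 0, by omega, by omega, Or.inl rfl, by norm_num; omega⟩
    · exact ⟨m, 1, 3 * m + 1, 1, 0, by omega, by omega,
        Or.inr ⟨by omega, Or.inl ⟨by omega, rfl, rfl⟩⟩, by norm_num; omega⟩
    · exact ⟨m, 1, 3 * m, Real.sqrt (1 / 2), Real.sqrt (1 / 2), by omega, by omega,
        Or.inr ⟨by omega, Or.inr ⟨by omega, by rw [hs]; norm_num, rfl⟩⟩, by norm_num; omega⟩
    · exact ⟨m + 1, 0, 0, 1, 0, by omega, by omega, Or.inl rfl, by norm_num; omega⟩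
    · exact ⟨m + 1, 0, 0, 1, 0, by omega, by omega, Or.inl rfl, by norm_num; omega⟩
  obtain ⟨M, e, y, al, be, h1, h2, h3, h4⟩ := h
  rw [← h4]
  exact construct n M e y al be h1 h2 h3

end
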